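/- Let O ⊂ ℝⁿ (n ≥ 2) be a bounded open set, σ ∈ C¹(O) with σ > 0, and u ∈ C²(O) with div(σ∇u) = 0 in O. Fix x₀ ∈ O. Then the function r ↦ H(x₀,r) is differentiable on (0, dist(x₀,∂O)) and for every such r, ∂_r H(x₀,r) = ((n−1)/r) H(x₀,r) + H̃(x₀,r) + 2 D(x₀,r), where H̃(x₀,r) = ∫_{∂B(x₀,r)} u² ∇σ·ν dS and ν(x) = (x−x₀)/r is the outward unit normal. Moreover 2D(x₀,r) = ∫_{∂B(x₀,r)} σ ∇(u²)·ν dS. -/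

import Mathlib

open MeasureTheory Metric Set
open scoped RealInnerProductSpace

noncomputable section

abbrev Euc (n : ℕ) := EuclideanSpace ℝ (Fin n)

/-- Divergence of a vector field on `ℝⁿ`. -/
noncomputable def vdiv {n : ℕ} (F : Euc n → Euc n) (x : Euc n) : ℝ :=
  ∑ i, fderiv ℝ F x (EuclideanSpace.single i 1) i

/-- Surface integral over the sphere `∂B(x₀,r)`:
`∫_{∂B(x₀,r)} f dS = r^{n−1} ∫_{S^{n−1}} f(x₀+rθ) dσ(θ)`, where `σ` is the
surface measure `volume.toSphere` on the unit sphere. -/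
noncomputable def sphIntB (n : ℕ) (x₀ : Euc n) (r : ℝ) (f : Euc n → ℝ) : ℝ :=
  r ^ (n - 1) *
    ∫ θ : Metric.sphere (0 : Euc n) 1, f (x₀ + r • (θ : Euc n))
      ∂((volume : Measure (Euc n)).toSphere)

/-- `H(x₀,r) = ∫_{∂B(x₀,r)} σ u² dS`. -/
noncomputable def Hfn {n : ℕ} (σ u : Euc n → ℝ) (x₀ : Euc n) (r : ℝ) : ℝ :=
  sphIntB n x₀ r (fun y => σ y * u y ^ 2)

/-- `D(x₀,r) = ∫_{B(x₀,r)} σ |∇u|² dx`. -/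
noncomputable def Dfn {n : ℕ} (σ u : Euc n → ℝ) (x₀ : Euc n) (r : ℝ) : ℝ :=
  ∫ x in ball x₀ r, σ x * ‖gradient u x‖ ^ 2

/-- `K(x₀,r) = ∫_{B(x₀,r)} σ u² dx`. -/
noncomputable def Kfn {n : ℕ} (σ u : Euc n → ℝ) (x₀ : Euc n) (r : ℝ) : ℝ :=
  ∫ x in ball x₀ r, σ x * u x ^ 2

/-- `H̃(x₀,r) = ∫_{∂B(x₀,r)} u² ∇σ·ν dS`, with `ν(x₀+rθ) = θ`. -/
noncomputable def Htilde {n : ℕ} (σ u : Euc n → ℝ) (x₀ : Euc n) (r : ℝ) : ℝ :=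
  r ^ (n - 1) *
    ∫ θ : Metric.sphere (0 : Euc n) 1,
      u (x₀ + r • (θ : Euc n)) ^ 2 * ⟪gradient σ (x₀ + r • (θ : Euc n)), (θ : Euc n)⟫
      ∂((volume : Measure (Euc n)).toSphere)

/-- `Ĥ(x₀,r) = ∫_{∂B(x₀,r)} σ (∂_ν u)² dS`, with `∂_ν u(x₀+rθ) = ∇u(x₀+rθ)·θ`. -/
noncomputable def Hhat {n : ℕ} (σ u : Euc n → ℝ) (x₀ : Euc n) (r : ℝ) : ℝ :=
  r ^ (n - 1) *
    ∫ θ : Metric.sphere (0 : Euc n) 1,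
      σ (x₀ + r • (θ : Euc n)) * ⟪gradient u (x₀ + r • (θ : Euc n)), (θ : Euc n)⟫ ^ 2
      ∂((volume : Measure (Euc n)).toSphere)

/-- `D̃(x₀,r) = ∫_{B(x₀,r)} |∇u|² ∇σ·(x−x₀) dx`. -/
noncomputable def Dtilde {n : ℕ} (σ u : Euc n → ℝ) (x₀ : Euc n) (r : ℝ) : ℝ :=
  ∫ x in ball x₀ r, ‖gradient u x‖ ^ 2 * ⟪gradient σ x, x - x₀⟫

theorem integral_polar {n : ℕ} (hn : n ≠ 0) {f : Euc n → ℝ} (hf : Integrable f) :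
    ∫ x, f x = ∫ ρ in Ioi (0 : ℝ), ρ ^ (n - 1) *
      ∫ θ : sphere (0 : Euc n) 1, f (ρ • (θ : Euc n)) ∂(volume : Measure (Euc n)).toSphere := by
  have : NeZero n := ⟨hn⟩
  have hmp := (volume : Measure (Euc n)).measurePreserving_homeomorphUnitSphereProd
  have hemb := (homeomorphUnitSphereProd (Euc n)).measurableEmbedding
  let g : sphere (0 : Euc n) 1 × Ioi (0 : ℝ) → ℝ := fun p => f ((p.2 : ℝ) • (p.1 : Euc n))
  have hg : (g ∘ homeomorphUnitSphereProd (Euc n)) = fun x : ({0}ᶜ : Set (Euc n)) => f x := by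
    funext x
    have hx : ‖(x : Euc n)‖ ≠ 0 := norm_ne_zero_iff.2 x.2
    simp [g, smul_smul, hx]
  have hgi : Integrable g ((volume : Measure (Euc n)).toSphere.prod
      (.volumeIoiPow (Module.finrank ℝ (Euc n) - 1))) := by
    rw [← hmp.integrable_comp_emb hemb, hg]
    exact (integrableOn_iff_comap_subtypeVal (measurableSet_singleton _).compl).1
      hf.integrableOn
  calc
    ∫ x, f x = ∫ x : ({0}ᶜ : Set (Euc n)), f x ∂((volume : Measure (Euc n)).comap (↑)) := by
      rw [integral_subtype_comap (measurableSet_singleton _).compl f,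
        restrict_compl_singleton]
    _ = ∫ p, g p ∂((volume : Measure (Euc n)).toSphere.prod
          (.volumeIoiPow (Module.finrank ℝ (Euc n) - 1))) := by
      rw [← hmp.integral_comp hemb]
      exact congrArg (integral _) hg.symm
    _ = _ := by
      rw [integral_prod_symm _ hgi]
      simp only [Measure.volumeIoiPow, ENNReal.ofReal, finrank_euclideanSpace_fin]
      rw [integral_withDensity_eq_integral_smul (by fun_prop),
        ← integral_subtype_comap measurableSet_Ioi fun ρ : ℝ => ρ ^ (n - 1) *
          ∫ θ : sphere (0 : Euc n) 1, f (ρ • (θ : Euc n)) ∂(volume : Measure (Euc n)).toSphere]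
      refine integral_congr_ae (.of_forall fun ρ => ?_)
      simp [g, NNReal.smul_def, Real.coe_toNNReal _ (pow_nonneg (le_of_lt ρ.2.out) _)]

theorem setIntegral_ball_polar {n : ℕ} (hn : n ≠ 0) {f : Euc n → ℝ} {x₀ : Euc n} {r : ℝ}
    (hr : 0 ≤ r) (hf : IntegrableOn f (ball x₀ r)) :
    ∫ x in ball x₀ r, f x = ∫ ρ in (0 : ℝ)..r, ρ ^ (n - 1) *
      ∫ θ : sphere (0 : Euc n) 1, f (x₀ + ρ • (θ : Euc n))
        ∂(volume : Measure (Euc n)).toSphere := by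
  have hi : Integrable (fun y => (ball x₀ r).indicator f (x₀ + y)) :=
    (integrable_indicator_iff measurableSet_ball |>.2 hf).comp_add_left x₀
  rw [← integral_indicator measurableSet_ball, ← integral_add_left_eq_self _ x₀,
    integral_polar hn hi, intervalIntegral.integral_of_le hr, integral_Ioc_eq_integral_Ioo,
    ← Ioi_inter_Iio, ← setIntegral_indicator measurableSet_Iio]
  refine setIntegral_congr_fun measurableSet_Ioi fun ρ hρ => ?_
  have hmem (θ : sphere (0 : Euc n) 1) : x₀ + ρ • (θ : Euc n) ∈ ball x₀ r ↔ ρ < r := by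
    simp [norm_smul, abs_of_pos (mem_Ioi.1 hρ)]
  by_cases h : ρ < r <;> simp [indicator, hmem, h]

theorem add_smul_mem_ball {n : ℕ} {x₀ : Euc n} {R ρ : ℝ} (hρ : ρ ∈ Ioo (-R) R)
    (θ : sphere (0 : Euc n) 1) : x₀ + ρ • (θ : Euc n) ∈ ball x₀ R := by
  simpa [norm_smul] using abs_lt.2 hρ

theorem continuous_comp_sphere {n : ℕ} {f : Euc n → ℝ} {x₀ : Euc n} {R ρ : ℝ}
    (hf : ContinuousOn f (ball x₀ R)) (hρ : ρ ∈ Ioo (-R) R) :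
    Continuous fun θ : sphere (0 : Euc n) 1 => f (x₀ + ρ • (θ : Euc n)) :=
  hf.comp_continuous (by fun_prop) fun θ => add_smul_mem_ball hρ θ

theorem exists_bound_sphere {n : ℕ} {f : Euc n → ℝ} {x₀ : Euc n} {R ρ : ℝ}
    (hf : ContinuousOn f (ball x₀ R)) (hρ : ρ ∈ Ioo (-R) R) :
    ∃ C : ℝ, ∃ s ∈ nhds ρ, s ⊆ Ioo (-R) R ∧
      ∀ t ∈ s, ∀ θ : sphere (0 : Euc n) 1, |f (x₀ + t • (θ : Euc n))| ≤ C := by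
  obtain ⟨R', h1, h2⟩ := exists_between (abs_lt.2 hρ)
  obtain ⟨C, hC⟩ := (isCompact_closedBall x₀ R').exists_bound_of_continuousOn
    (hf.mono (closedBall_subset_ball h2))
  refine ⟨C, Ioo (-R') R', Ioo_mem_nhds (abs_lt.1 h1).1 (abs_lt.1 h1).2,
    Ioo_subset_Ioo (by linarith) h2.le, fun t ht θ => ?_⟩
  exact hC _ (ball_subset_closedBall (add_smul_mem_ball ht θ))

theorem continuousOn_sphereIntegral {n : ℕ} {f : Euc n → ℝ} {x₀ : Euc n} {R : ℝ}
    (hf : ContinuousOn f (ball x₀ R)) :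
    ContinuousOn (fun ρ : ℝ => ∫ θ : sphere (0 : Euc n) 1, f (x₀ + ρ • (θ : Euc n))
      ∂(volume : Measure (Euc n)).toSphere) (Ioo (-R) R) := by
  intro ρ hρ
  obtain ⟨C, s, hs, hsR, hC⟩ := exists_bound_sphere hf hρ
  refine (continuousAt_of_dominated (bound := fun _ => C) ?_ ?_ (integrable_const _)
    ?_).continuousWithinAt
  · filter_upwards [hs] with t ht
    exact (continuous_comp_sphere hf (hsR ht)).aestronglyMeasurable
  · filter_upwards [hs] with t ht
    exact .of_forall fun θ => hC t ht θ
  · refine .of_forall fun θ => ContinuousAt.comp (g := f) (f := fun t : ℝ => x₀ + t • (θ : Euc n))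
      (hf.continuousAt (isOpen_ball.mem_nhds (add_smul_mem_ball hρ θ))) (by fun_prop)

theorem hasDerivAt_sphereIntegral {n : ℕ} {f : Euc n → ℝ} {x₀ : Euc n} {R r : ℝ}
    (hf : ContDiffOn ℝ 1 f (ball x₀ R)) (hr : r ∈ Ioo (-R) R) :
    HasDerivAt (fun ρ : ℝ => ∫ θ : sphere (0 : Euc n) 1, f (x₀ + ρ • (θ : Euc n))
        ∂(volume : Measure (Euc n)).toSphere)
      (∫ θ : sphere (0 : Euc n) 1, ⟪gradient f (x₀ + r • (θ : Euc n)), (θ : Euc n)⟫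
        ∂(volume : Measure (Euc n)).toSphere) r := by
  have hf' : ContinuousOn (fderiv ℝ f) (ball x₀ R) :=
    hf.continuousOn_fderiv_of_isOpen isOpen_ball le_rfl
  obtain ⟨R', h1, h2⟩ := exists_between (abs_lt.2 hr)
  have hsub : Ioo (-R') R' ⊆ Ioo (-R) R := Ioo_subset_Ioo (by linarith) h2.le
  have hs : Ioo (-R') R' ∈ nhds r := Ioo_mem_nhds (abs_lt.1 h1).1 (abs_lt.1 h1).2
  obtain ⟨C, hC⟩ := (isCompact_closedBall x₀ R').exists_bound_of_continuousOn
    (hf'.mono (closedBall_subset_ball h2))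
  simp only [inner_gradient_left]
  refine (hasDerivAt_integral_of_dominated_loc_of_deriv_le (bound := fun _ => C)
    (F' := fun t (θ : sphere (0 : Euc n) 1) => fderiv ℝ f (x₀ + t • (θ : Euc n)) θ)
    hs ?_ ?_ ?_ ?_ (integrable_const C) ?_).2
  · filter_upwards [hs] with t ht
    exact (continuous_comp_sphere hf.continuousOn (hsub ht)).aestronglyMeasurable
  · exact (continuous_comp_sphere hf.continuousOn hr).integrable_of_hasCompactSupport
      (.of_compactSpace _)
  · refine Continuous.aestronglyMeasurable ?_
    exact (hf'.comp_continuous (f := fun θ : sphere (0 : Euc n) 1 => x₀ + r • (θ : Euc n))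
      (by fun_prop) fun θ => add_smul_mem_ball hr θ).clm_apply continuous_subtype_val
  · refine .of_forall fun θ t ht => ?_
    refine (ContinuousLinearMap.le_opNorm _ _).trans ?_
    simpa using hC _ (ball_subset_closedBall (add_smul_mem_ball ht θ))
  · refine .of_forall fun θ t ht => ?_
    have hd : HasFDerivAt f (fderiv ℝ f (x₀ + t • (θ : Euc n))) (x₀ + t • (θ : Euc n)) :=
      ((hf.differentiableOn one_ne_zero).differentiableAt
        (isOpen_ball.mem_nhds (add_smul_mem_ball (hsub ht) θ))).hasFDerivAt
    have hl : HasDerivAt (fun t : ℝ => x₀ + t • (θ : Euc n)) (θ : Euc n) t := by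
      simpa using ((hasDerivAt_id t).smul_const (θ : Euc n)).const_add x₀
    exact hd.comp_hasDerivAt t hl

theorem integral_vdiv_eq_zero {n : ℕ} {V : Euc n → Euc n} (hV : Differentiable ℝ V)
    (hVi : Integrable V) (hVi' : Integrable (fderiv ℝ V)) : ∫ x, vdiv V x = 0 := by
  have hfd (i : Fin n) (x : Euc n) : fderiv ℝ (fun y => V y i) x (EuclideanSpace.single i 1)
      = fderiv ℝ V x (EuclideanSpace.single i 1) i := by
    have := ((EuclideanSpace.proj i : Euc n →L[ℝ] ℝ).hasFDerivAt.comp x (hV x).hasFDerivAt).fderiv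
    exact congrArg (fun L => L (EuclideanSpace.single i (1 : ℝ))) this
  have hint (i : Fin n) : Integrable fun x => fderiv ℝ V x (EuclideanSpace.single i 1) i :=
    (EuclideanSpace.proj i : Euc n →L[ℝ] ℝ).integrable_comp
      (hVi'.apply_continuousLinearMap (EuclideanSpace.single i 1))
  have hint0 (i : Fin n) : Integrable fun x => V x i :=
    (EuclideanSpace.proj i : Euc n →L[ℝ] ℝ).integrable_comp hVi
  unfold vdiv
  rw [integral_finsetSum _ fun i _ => hint i]
  refine Finset.sum_eq_zero fun i _ => ?_
  have := integral_mul_fderiv_eq_neg_fderiv_mul_of_integrable (μ := (volume : Measure (Euc n)))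
    (f := fun _ => (1 : ℝ)) (g := fun x => V x i) (v := EuclideanSpace.single i 1)
    (by simp) (by simpa [hfd] using hint i) (by simpa using hint0 i) (by fun_prop)
    (fun x _ => by have := hV x; fun_prop)
  simpa [hfd] using this

theorem hasDerivAt_integral_of_continuousOn_Ioo {k : ℝ → ℝ} {R r : ℝ}
    (hk : ContinuousOn k (Ioo (-R) R)) (hr : r ∈ Ioo (-R) R) :
    HasDerivAt (fun s => ∫ ρ in (0 : ℝ)..s, k ρ) (k r) r := by
  have h0 : (0 : ℝ) ∈ Ioo (-R) R := by constructor <;> linarith [hr.1, hr.2]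
  refine intervalIntegral.integral_hasDerivAt_right ?_
    (hk.stronglyMeasurableAtFilter isOpen_Ioo r hr) (hk.continuousAt (Ioo_mem_nhds hr.1 hr.2))
  exact (hk.mono (ordConnected_Ioo.uIcc_subset h0 hr)).intervalIntegrable

theorem vdiv_eq_of_hasFDerivAt {n : ℕ} {V : Euc n → Euc n} {L : Euc n →L[ℝ] Euc n} {x : Euc n}
    (h : HasFDerivAt V L x) : vdiv V x = ∑ i, L (EuclideanSpace.single i 1) i := by
  rw [vdiv, h.fderiv]

theorem sum_smul_add_smulRight_apply {n : ℕ} (a : ℝ) (L : Euc n →L[ℝ] Euc n)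
    (l : Euc n →L[ℝ] ℝ) (v : Euc n) :
    ∑ i, (a • L + l.smulRight v) (EuclideanSpace.single i 1) i
      = a * ∑ i, L (EuclideanSpace.single i 1) i + l v := by
  have hv : l v = ∑ i, v i * l (EuclideanSpace.single i 1) := by
    conv_lhs => rw [← (EuclideanSpace.basisFun (Fin n) ℝ).sum_repr v]
    simp
  simp [hv, Finset.sum_add_distrib, Finset.mul_sum, mul_comm]

theorem continuousOn_vdiv {n : ℕ} {F : Euc n → Euc n} {s : Set (Euc n)}
    (hF : ContinuousOn (fderiv ℝ F) s) : ContinuousOn (vdiv F) s :=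
  continuousOn_finsetSum _ fun i _ =>
    (EuclideanSpace.proj i : Euc n →L[ℝ] ℝ).continuous.comp_continuousOn
      (hF.clm_apply continuousOn_const)

theorem vdiv_smul {n : ℕ} {c : Euc n → ℝ} {W : Euc n → Euc n} {x : Euc n}
    (hc : DifferentiableAt ℝ c x) (hW : DifferentiableAt ℝ W x) :
    vdiv (fun y => c y • W y) x = c x * vdiv W x + fderiv ℝ c x (W x) := by
  rw [vdiv_eq_of_hasFDerivAt (hc.hasFDerivAt.fun_smul hW.hasFDerivAt), sum_smul_add_smulRight_apply,
    vdiv]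

theorem hasDerivAt_max_zero_sq (t : ℝ) :
    HasDerivAt (fun s : ℝ => max s 0 ^ 2) (2 * max t 0) t := by
  rcases lt_trichotomy t 0 with h | rfl | h
  · have : (fun s : ℝ => max s 0 ^ 2) =ᶠ[nhds t] fun _ => 0 := by
      filter_upwards [Iio_mem_nhds h] with s hs
      simp [max_eq_right (le_of_lt (mem_Iio.1 hs))]
    simpa [max_eq_right h.le] using (hasDerivAt_const t (0 : ℝ)).congr_of_eventuallyEq this
  · rw [hasDerivAt_iff_isLittleO]
    refine Asymptotics.IsBigO.trans_isLittleO (g := fun s : ℝ => s ^ 2) ?_ ?_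
    · refine Asymptotics.IsBigO.of_bound 1 (.of_forall fun s => ?_)
      rcases le_total s 0 with hs | hs <;> simp [hs, sq_nonneg]
    · simpa using Asymptotics.isLittleO_pow_id (𝕜 := ℝ) one_lt_two
  · have : (fun s : ℝ => max s 0 ^ 2) =ᶠ[nhds t] fun s => s ^ 2 := by
      filter_upwards [Ioi_mem_nhds h] with s hs
      simp [max_eq_left (le_of_lt (mem_Ioi.1 hs))]
    simpa [max_eq_left h.le] using (hasDerivAt_pow 2 t).congr_of_eventuallyEq this

theorem hasFDerivAt_max_sq_sub_norm_sq {n : ℕ} (x₀ x : Euc n) (r : ℝ) :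
    HasFDerivAt (fun y : Euc n => max (r ^ 2 - ‖y - x₀‖ ^ 2) 0 ^ 2)
      ((-(4 * max (r ^ 2 - ‖x - x₀‖ ^ 2) 0)) • innerSL ℝ (x - x₀)) x := by
  have h1 : HasFDerivAt (fun y : Euc n => r ^ 2 - ‖y - x₀‖ ^ 2)
      (-(2 • innerSL ℝ (x - x₀))) x := by
    have := (((hasFDerivAt_id x).sub_const x₀).norm_sq).const_sub (r ^ 2)
    simpa using this
  refine ((hasDerivAt_max_zero_sq _).comp_hasFDerivAt x h1).congr_fderiv ?_
  ext v
  simp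
  ring

theorem integrable_of_continuousOn_closedBall {n : ℕ} {E : Type*} [NormedAddCommGroup E]
    {f : Euc n → E} {x₀ : Euc n} {r : ℝ} (hf : ContinuousOn f (closedBall x₀ r))
    (h0 : ∀ x ∉ closedBall x₀ r, f x = 0) : Integrable f :=
  (integrableOn_iff_integrable_of_support_subset
    (Function.support_subset_iff'.2 h0)).1 (hf.integrableOn_compact (isCompact_closedBall x₀ r))

theorem integral_weight_mul_vdiv {n : ℕ} {F : Euc n → Euc n} {x₀ : Euc n} {R r : ℝ}
    (hF : ContDiffOn ℝ 1 F (ball x₀ R)) (hr0 : 0 < r) (hrR : r < R) :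
    ∫ x in ball x₀ r, (r ^ 2 - ‖x - x₀‖ ^ 2) ^ 2 * vdiv F x
      = ∫ x in ball x₀ r, 4 * (r ^ 2 - ‖x - x₀‖ ^ 2) * ⟪F x, x - x₀⟫ := by
  have hsub : closedBall x₀ r ⊆ ball x₀ R := closedBall_subset_ball hrR
  have hFc : ContinuousOn F (closedBall x₀ r) := hF.continuousOn.mono hsub
  have hFc' : ContinuousOn (fderiv ℝ F) (closedBall x₀ r) :=
    (hF.continuousOn_fderiv_of_isOpen isOpen_ball le_rfl).mono hsub
  have hmax {x : Euc n} (hx : x ∉ ball x₀ r) : max (r ^ 2 - ‖x - x₀‖ ^ 2) 0 = 0 := by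
    rw [mem_ball_iff_norm, not_lt] at hx
    exact max_eq_right (by nlinarith)
  have hmax' {x : Euc n} (hx : x ∈ ball x₀ r) :
      max (r ^ 2 - ‖x - x₀‖ ^ 2) 0 = r ^ 2 - ‖x - x₀‖ ^ 2 := by
    rw [mem_ball_iff_norm] at hx
    exact max_eq_left (by nlinarith [norm_nonneg (x - x₀)])
  have hmc : Continuous fun x : Euc n => max (r ^ 2 - ‖x - x₀‖ ^ 2) 0 := by fun_prop
  set V : Euc n → Euc n := fun x => (max (r ^ 2 - ‖x - x₀‖ ^ 2) 0 ^ 2) • F x with hVdef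
  let V' : Euc n → Euc n →L[ℝ] Euc n := fun x =>
    (max (r ^ 2 - ‖x - x₀‖ ^ 2) 0 ^ 2) • fderiv ℝ F x +
      ((-(4 * max (r ^ 2 - ‖x - x₀‖ ^ 2) 0)) • innerSL ℝ (x - x₀)).smulRight (F x)
  have hV (x : Euc n) : HasFDerivAt V (V' x) x := by
    by_cases hx : x ∈ ball x₀ R
    · exact (hasFDerivAt_max_sq_sub_norm_sq x₀ x r).smul
        ((hF.differentiableOn one_ne_zero).differentiableAt
          (isOpen_ball.mem_nhds hx)).hasFDerivAt
    · have hx' : x ∈ (closedBall x₀ r)ᶜ := fun h => hx (hsub h)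
      have hz : V =ᶠ[nhds x] fun _ => 0 := by
        filter_upwards [isClosed_closedBall.isOpen_compl.mem_nhds hx'] with y hy
        simp [hVdef, hmax fun h => hy (ball_subset_closedBall h)]
      have hV'x : V' x = 0 := by
        ext v
        simp [V', hmax fun h => hx' (ball_subset_closedBall h)]
      rw [hV'x]
      exact (hasFDerivAt_const (0 : Euc n) x).congr_of_eventuallyEq hz
  have hfd : fderiv ℝ V = V' := funext fun x => (hV x).fderiv
  have hVi : Integrable V := by
    refine integrable_of_continuousOn_closedBall (x₀ := x₀) (r := r) ?_ fun x hx => ?_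
    · exact (hmc.pow 2).continuousOn.smul hFc
    · simp [hVdef, hmax fun h => hx (ball_subset_closedBall h)]
  have hVi' : Integrable (fderiv ℝ V) := by
    rw [hfd]
    refine integrable_of_continuousOn_closedBall (x₀ := x₀) (r := r) ?_ fun x hx => ?_
    · refine ContinuousOn.add ((hmc.pow 2).continuousOn.smul hFc') ?_
      refine ContinuousOn.clm_apply (f := fun x => ContinuousLinearMap.smulRightL ℝ (Euc n) (Euc n)
        ((-(4 * max (r ^ 2 - ‖x - x₀‖ ^ 2) 0)) • innerSL ℝ (x - x₀))) ?_ hFc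
      fun_prop
    · ext v
      simp [V', hmax fun h => hx (ball_subset_closedBall h)]
  have hdiv (x : Euc n) : vdiv V x = max (r ^ 2 - ‖x - x₀‖ ^ 2) 0 ^ 2 * vdiv F x
      - 4 * max (r ^ 2 - ‖x - x₀‖ ^ 2) 0 * ⟪F x, x - x₀⟫ := by
    rw [vdiv_eq_of_hasFDerivAt (hV x), sum_smul_add_smulRight_apply, vdiv]
    have hin : innerSL ℝ (x - x₀) (F x) = ⟪F x, x - x₀⟫ := by
      rw [innerSL_apply_apply, real_inner_comm]
    simp only [smul_apply, hin, smul_eq_mul]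
    ring
  have hzero := integral_vdiv_eq_zero (fun x => (hV x).differentiableAt) hVi hVi'
  rw [← setIntegral_eq_integral_of_forall_compl_eq_zero (s := ball x₀ r)
    (fun x hx => by simp [hdiv, hmax hx]),
    setIntegral_congr_fun measurableSet_ball (g := fun x =>
      (r ^ 2 - ‖x - x₀‖ ^ 2) ^ 2 * vdiv F x - 4 * (r ^ 2 - ‖x - x₀‖ ^ 2) * ⟪F x, x - x₀⟫)
      (fun x hx => by simp only [hdiv, hmax' hx]), integral_sub, sub_eq_zero] at hzero
  · exact hzero
  · refine (ContinuousOn.integrableOn_compact (isCompact_closedBall x₀ r) ?_).mono_set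
      ball_subset_closedBall
    exact ContinuousOn.mul (by fun_prop) (continuousOn_vdiv hFc')
  · refine (ContinuousOn.integrableOn_compact (isCompact_closedBall x₀ r) ?_).mono_set
      ball_subset_closedBall
    fun_prop

theorem mul_integral_eq_of_weighted {G p : ℝ → ℝ} {R : ℝ} (hG : ContinuousOn G (Ioo (-R) R))
    (hp : ContinuousOn p (Ioo (-R) R))
    (h : ∀ r ∈ Ioo 0 R, ∫ ρ in (0 : ℝ)..r, (r ^ 2 - ρ ^ 2) ^ 2 * G ρ
      = ∫ ρ in (0 : ℝ)..r, 4 * (r ^ 2 - ρ ^ 2) * p ρ) :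
    ∀ r ∈ Ioo 0 R, r * ∫ ρ in (0 : ℝ)..r, G ρ = p r := by
  have hsub {r : ℝ} (hr : r ∈ Ioo 0 R) : r ∈ Ioo (-R) R :=
    ⟨by linarith [hr.1, hr.2], hr.2⟩
  have hint {k : ℝ → ℝ} (hk : ContinuousOn k (Ioo (-R) R)) {r : ℝ} (hr : r ∈ Ioo 0 R) :
      IntervalIntegrable k volume 0 r :=
    (hk.mono (ordConnected_Ioo.uIcc_subset ⟨by linarith [hr.1, hr.2], by linarith [hr.1, hr.2]⟩
      (hsub hr))).intervalIntegrable
  have hG2 : ContinuousOn (fun ρ => ρ ^ 2 * G ρ) (Ioo (-R) R) := by fun_prop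
  have hG4 : ContinuousOn (fun ρ => ρ ^ 4 * G ρ) (Ioo (-R) R) := by fun_prop
  have hp2 : ContinuousOn (fun ρ => ρ ^ 2 * p ρ) (Ioo (-R) R) := by fun_prop
  have hmoments : ∀ r ∈ Ioo 0 R,
      r ^ 4 * (∫ ρ in (0 : ℝ)..r, G ρ) - 2 * r ^ 2 * (∫ ρ in (0 : ℝ)..r, ρ ^ 2 * G ρ)
          + (∫ ρ in (0 : ℝ)..r, ρ ^ 4 * G ρ)
        = 4 * r ^ 2 * (∫ ρ in (0 : ℝ)..r, p ρ) - 4 * ∫ ρ in (0 : ℝ)..r, ρ ^ 2 * p ρ := by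
    intro r hr
    have e1 : ∀ ρ, (r ^ 2 - ρ ^ 2) ^ 2 * G ρ
        = r ^ 4 * G ρ - 2 * r ^ 2 * (ρ ^ 2 * G ρ) + ρ ^ 4 * G ρ := fun ρ => by ring
    have e2 : ∀ ρ, 4 * (r ^ 2 - ρ ^ 2) * p ρ = 4 * r ^ 2 * p ρ - 4 * (ρ ^ 2 * p ρ) :=
      fun ρ => by ring
    have := h r hr
    simp only [e1, e2] at this
    rwa [intervalIntegral.integral_add
        (((hint hG hr).const_mul _).sub ((hint hG2 hr).const_mul _)) (hint hG4 hr),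
      intervalIntegral.integral_sub ((hint hG hr).const_mul _) ((hint hG2 hr).const_mul _),
      intervalIntegral.integral_sub ((hint hp hr).const_mul _) ((hint hp2 hr).const_mul _),
      intervalIntegral.integral_const_mul, intervalIntegral.integral_const_mul,
      intervalIntegral.integral_const_mul, intervalIntegral.integral_const_mul] at this
  have hmoments' : ∀ r ∈ Ioo 0 R,
      r ^ 2 * (∫ ρ in (0 : ℝ)..r, G ρ) - (∫ ρ in (0 : ℝ)..r, ρ ^ 2 * G ρ)
        = 2 * ∫ ρ in (0 : ℝ)..r, p ρ := by
    intro r hr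
    have hr' := hsub hr
    have d1 := ((((hasDerivAt_pow 4 r).mul (hasDerivAt_integral_of_continuousOn_Ioo hG hr')).sub
      (((hasDerivAt_pow 2 r).const_mul 2).mul
        (hasDerivAt_integral_of_continuousOn_Ioo hG2 hr'))).add
      (hasDerivAt_integral_of_continuousOn_Ioo hG4 hr'))
    have d2 := (((hasDerivAt_pow 2 r).const_mul 4).mul
      (hasDerivAt_integral_of_continuousOn_Ioo hp hr')).sub
      ((hasDerivAt_integral_of_continuousOn_Ioo hp2 hr').const_mul 4)
    have := d1.unique (d2.congr_of_eventuallyEq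
      (Filter.eventuallyEq_of_mem (Ioo_mem_nhds hr.1 hr.2) hmoments))
    norm_num at this
    refine mul_left_cancel₀ (mul_ne_zero (four_ne_zero (α := ℝ)) hr.1.ne') ?_
    linear_combination this
  intro r hr
  have hr' := hsub hr
  have d1 := ((hasDerivAt_pow 2 r).mul (hasDerivAt_integral_of_continuousOn_Ioo hG hr')).sub
    (hasDerivAt_integral_of_continuousOn_Ioo hG2 hr')
  have d2 := (hasDerivAt_integral_of_continuousOn_Ioo hp hr').const_mul 2
  have := d1.unique (d2.congr_of_eventuallyEq
    (Filter.eventuallyEq_of_mem (Ioo_mem_nhds hr.1 hr.2) hmoments'))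
  norm_num at this
  linear_combination this / 2

/-- **Divergence theorem** on a Euclidean ball. -/
theorem setIntegral_ball_vdiv {n : ℕ} (hn : n ≠ 0) {F : Euc n → Euc n} {x₀ : Euc n} {R r : ℝ}
    (hF : ContDiffOn ℝ 1 F (ball x₀ R)) (hr : r ∈ Ioo 0 R) :
    ∫ x in ball x₀ r, vdiv F x = r ^ (n - 1) *
      ∫ θ : sphere (0 : Euc n) 1, ⟪F (x₀ + r • (θ : Euc n)), (θ : Euc n)⟫
        ∂(volume : Measure (Euc n)).toSphere := by
  have hFc : ContinuousOn F (ball x₀ R) := hF.continuousOn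
  have hdc : ContinuousOn (vdiv F) (ball x₀ R) :=
    continuousOn_vdiv (hF.continuousOn_fderiv_of_isOpen isOpen_ball le_rfl)
  have hfc : ContinuousOn (fun x => ⟪F x, x - x₀⟫) (ball x₀ R) := by fun_prop
  have hint {s : ℝ} (hs : s ∈ Ioo 0 R) {f : Euc n → ℝ} (hf : ContinuousOn f (ball x₀ R)) :
      IntegrableOn f (ball x₀ s) :=
    ((hf.mono (closedBall_subset_ball hs.2)).integrableOn_compact
      (isCompact_closedBall x₀ s)).mono_set ball_subset_closedBall
  have hnorm (ρ : ℝ) (θ : sphere (0 : Euc n) 1) : ‖x₀ + ρ • (θ : Euc n) - x₀‖ ^ 2 = ρ ^ 2 := by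
    simp [norm_smul]
  have key := mul_integral_eq_of_weighted (R := R)
    (G := fun ρ => ρ ^ (n - 1) * ∫ θ : sphere (0 : Euc n) 1, vdiv F (x₀ + ρ • (θ : Euc n))
      ∂(volume : Measure (Euc n)).toSphere)
    (p := fun ρ => ρ ^ (n - 1) * ∫ θ : sphere (0 : Euc n) 1,
      ⟪F (x₀ + ρ • (θ : Euc n)), x₀ + ρ • (θ : Euc n) - x₀⟫
      ∂(volume : Measure (Euc n)).toSphere)
    ((continuousOn_pow _).mul (continuousOn_sphereIntegral hdc))
    ((continuousOn_pow _).mul (continuousOn_sphereIntegral hfc)) ?_ r hr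
  · rw [← setIntegral_ball_polar hn hr.1.le (hint hr hdc)] at key
    simp only [add_sub_cancel_left, inner_smul_right, integral_const_mul] at key
    refine mul_left_cancel₀ hr.1.ne' (key.trans ?_)
    ring
  · intro s hs
    have := integral_weight_mul_vdiv hF hs.1 hs.2
    rw [setIntegral_ball_polar hn hs.1.le (hint hs (by fun_prop)),
      setIntegral_ball_polar hn hs.1.le (hint hs (by fun_prop))] at this
    simp only [hnorm, integral_const_mul] at this
    simpa only [mul_left_comm] using this

theorem ball_infDist_frontier_subset {n : ℕ} {O : Set (Euc n)} (hO : IsOpen O) {x₀ : Euc n}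
    (hx₀ : x₀ ∈ O) : ball x₀ (infDist x₀ (frontier O)) ⊆ O := by
  rcases le_or_gt (infDist x₀ (frontier O)) 0 with h | h
  · simp [ball_eq_empty.2 h]
  refine (convex_ball x₀ _).isPreconnected.subset_left_of_subset_union hO
    isClosed_closure.isOpen_compl (disjoint_compl_right.mono_left subset_closure) ?_
    ⟨x₀, mem_ball_self h, hx₀⟩
  intro x hx
  by_contra hx'
  rw [mem_union, not_or, mem_compl_iff, not_not] at hx'
  exact disjoint_ball_infDist.le_bot ⟨hx, hx'.2, by rw [hO.interior_eq]; exact hx'.1⟩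

theorem gradient_sq {n : ℕ} {u : Euc n → ℝ} {x : Euc n} (hu : DifferentiableAt ℝ u x) :
    gradient (fun y => u y ^ 2) x = (2 * u x) • gradient u x := by
  refine ext_inner_right ℝ fun v => ?_
  rw [real_inner_smul_left, inner_gradient_left, inner_gradient_left,
    (hu.hasFDerivAt.pow 2).fderiv]
  simp

theorem inner_gradient_mul_sq {n : ℕ} {σ u : Euc n → ℝ} {x : Euc n} (hσ : DifferentiableAt ℝ σ x)
    (hu : DifferentiableAt ℝ u x) (v : Euc n) :
    ⟪gradient (fun y => σ y * u y ^ 2) x, v⟫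
      = u x ^ 2 * ⟪gradient σ x, v⟫ + σ x * ⟪gradient (fun y => u y ^ 2) x, v⟫ := by
  simp only [inner_gradient_left]
  rw [(hσ.hasFDerivAt.fun_mul (hu.fun_pow 2).hasFDerivAt).fderiv]
  simp
  ring

theorem contDiffOn_gradient {n : ℕ} {u : Euc n → ℝ} {s : Set (Euc n)} (hs : IsOpen s)
    (hu : ContDiffOn ℝ 2 u s) : ContDiffOn ℝ 1 (gradient u) s :=
  (InnerProductSpace.toDual ℝ (Euc n)).symm.contDiff.comp_contDiffOn
    (hu.fderiv_of_isOpen hs (by norm_num))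

/-- Derivative of `H`: `H' = ((n−1)/r) H + H̃ + 2D`, together with
`2D = ∫_{∂B} σ ∇(u²)·ν dS`. -/
theorem stmt11 (n : ℕ) (hn : 2 ≤ n) (O : Set (Euc n)) (hO : IsOpen O)
    (hObd : Bornology.IsBounded O) (σ u : Euc n → ℝ)
    (hσ : ContDiffOn ℝ 1 σ O) (hσpos : ∀ x ∈ O, 0 < σ x)
    (hu : ContDiffOn ℝ 2 u O)
    (hpde : ∀ x ∈ O, vdiv (fun y => σ y • gradient u y) x = 0)
    (x₀ : Euc n) (hx₀ : x₀ ∈ O) :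
    ∀ r ∈ Ioo (0 : ℝ) (infDist x₀ (frontier O)),
      HasDerivAt (fun ρ => Hfn σ u x₀ ρ)
        (((n : ℝ) - 1) / r * Hfn σ u x₀ r + Htilde σ u x₀ r + 2 * Dfn σ u x₀ r) r ∧
      2 * Dfn σ u x₀ r
        = r ^ (n - 1) *
            ∫ θ : Metric.sphere (0 : Euc n) 1,
              σ (x₀ + r • (θ : Euc n))
                * ⟪gradient (fun y => u y ^ 2) (x₀ + r • (θ : Euc n)), (θ : Euc n)⟫
              ∂((volume : Measure (Euc n)).toSphere) := by
  intro r hr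
  set R := infDist x₀ (frontier O)
  have hsub : ball x₀ R ⊆ O := ball_infDist_frontier_subset hO hx₀
  have hn0 : n ≠ 0 := by omega
  replace hσ := hσ.mono hsub
  replace hu := hu.mono hsub
  have hu1 : ContDiffOn ℝ 1 u (ball x₀ R) := hu.of_le one_le_two
  have hg : ContDiffOn ℝ 1 (gradient u) (ball x₀ R) := contDiffOn_gradient isOpen_ball hu
  have hσd {x : Euc n} (hx : x ∈ ball x₀ R) : DifferentiableAt ℝ σ x :=
    (hσ.differentiableOn one_ne_zero).differentiableAt (isOpen_ball.mem_nhds hx)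
  have hud {x : Euc n} (hx : x ∈ ball x₀ R) : DifferentiableAt ℝ u x :=
    (hu1.differentiableOn one_ne_zero).differentiableAt (isOpen_ball.mem_nhds hx)
  have hgd {x : Euc n} (hx : x ∈ ball x₀ R) : DifferentiableAt ℝ (gradient u) x :=
    (hg.differentiableOn one_ne_zero).differentiableAt (isOpen_ball.mem_nhds hx)
  have hr' : r ∈ Ioo (-R) R := ⟨by linarith [hr.1, hr.2], hr.2⟩
  have hmem (θ : sphere (0 : Euc n) 1) : x₀ + r • (θ : Euc n) ∈ ball x₀ R :=
    add_smul_mem_ball hr' θ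
  have hD : 2 * Dfn σ u x₀ r = r ^ (n - 1) * ∫ θ : sphere (0 : Euc n) 1,
      σ (x₀ + r • (θ : Euc n))
        * ⟪gradient (fun y => u y ^ 2) (x₀ + r • (θ : Euc n)), (θ : Euc n)⟫
      ∂((volume : Measure (Euc n)).toSphere) := by
    have hF : ContDiffOn ℝ 1 (fun y => (2 * u y) • σ y • gradient u y) (ball x₀ R) := by
      fun_prop
    rw [Dfn, ← integral_const_mul]
    calc
      _ = ∫ x in ball x₀ r, vdiv (fun y => (2 * u y) • σ y • gradient u y) x := by
        refine setIntegral_congr_fun measurableSet_ball fun x hx => ?_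
        have hx' : x ∈ ball x₀ R := ball_subset_ball hr.2.le hx
        have h1 : fderiv ℝ (fun y => 2 * u y) x = (2 : ℝ) • fderiv ℝ u x :=
          ((hud hx').hasFDerivAt.const_mul 2).fderiv
        rw [vdiv_smul ((hud hx').const_mul 2) ((hσd hx').fun_smul (hgd hx')), hpde x (hsub hx'), h1,
          smul_apply, map_smul, ← inner_gradient_left,
          real_inner_self_eq_norm_sq]
        simp
      _ = _ := by
        rw [setIntegral_ball_vdiv hn0 hF hr]
        congr 2
        funext θ
        rw [gradient_sq (hud (hmem θ))]
        simp only [real_inner_smul_left]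
        ring
  refine ⟨?_, hD⟩
  have hderiv := (hasDerivAt_pow (n - 1) r).fun_mul (hasDerivAt_sphereIntegral (r := r)
    (hσ.mul (hu1.pow 2)) hr')
  refine hderiv.congr_deriv ?_
  have hcont {f : Euc n → Euc n} (hf : ContinuousOn f (ball x₀ R)) :
      Continuous fun θ : sphere (0 : Euc n) 1 => f (x₀ + r • (θ : Euc n)) :=
    hf.comp_continuous (by fun_prop) hmem
  have hgσ : ContinuousOn (gradient σ) (ball x₀ R) :=
    (InnerProductSpace.toDual ℝ (Euc n)).symm.continuous.comp_continuousOn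
      (hσ.continuousOn_fderiv_of_isOpen isOpen_ball le_rfl)
  have hgu : ContinuousOn (gradient fun y => u y ^ 2) (ball x₀ R) :=
    (InnerProductSpace.toDual ℝ (Euc n)).symm.continuous.comp_continuousOn
      ((hu1.pow 2).continuousOn_fderiv_of_isOpen isOpen_ball le_rfl)
  have hcσ := continuous_comp_sphere hσ.continuousOn hr'
  have hcu := continuous_comp_sphere hu1.continuousOn hr'
  have hsplit : ∫ θ : sphere (0 : Euc n) 1,
        ⟪gradient (fun y => σ y * u y ^ 2) (x₀ + r • (θ : Euc n)), (θ : Euc n)⟫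
        ∂((volume : Measure (Euc n)).toSphere)
      = ∫ θ : sphere (0 : Euc n) 1, (u (x₀ + r • (θ : Euc n)) ^ 2
            * ⟪gradient σ (x₀ + r • (θ : Euc n)), (θ : Euc n)⟫
          + σ (x₀ + r • (θ : Euc n))
            * ⟪gradient (fun y => u y ^ 2) (x₀ + r • (θ : Euc n)), (θ : Euc n)⟫)
        ∂((volume : Measure (Euc n)).toSphere) :=
    integral_congr_ae (.of_forall fun θ =>
      inner_gradient_mul_sq (hσd (hmem θ)) (hud (hmem θ)) _)
  rw [hsplit, integral_add, hD, Hfn, sphIntB, Htilde, Nat.cast_pred (by omega)]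
  · have hpow : r ^ (n - 1) = r ^ (n - 1 - 1) * r := by
      rw [← pow_succ]
      congr 1
      omega
    have hr0 : r ≠ 0 := hr.1.ne'
    rw [hpow]
    field_simp
    ring
  · exact Continuous.integrable_of_hasCompactSupport
      ((hcu.pow 2).mul ((hcont hgσ).inner continuous_subtype_val))
      (.of_compactSpace _)
  · exact Continuous.integrable_of_hasCompactSupport
      (hcσ.mul ((hcont hgu).inner continuous_subtype_val))
      (.of_compactSpace _)

end
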